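/- Let Φ be a Euclidean ring, z ∈ Φ a nonzero non-unit, and A = Φ⟨x₁,x₂⟩ the free nonassociative algebra on x₁, x₂ over Φ. The automorphism η of A defined by η(x₁) = x₁ + x₂(zx₁ − x₂²) + (zx₁ − x₂²)x₂ + z(zx₁ − x₂²)² and η(x₂) = x₂ + z(zx₁ − x₂²) is wild, i.e., η does not belong to the subgroup of Aut(A) generated by elementary automorphisms. -/

import Mathlib

open MvPolynomial

/-- The free nonassociative (non-unital, non-associative) algebra `Φ⟨x₁,x₂⟩` on two free
generators over `Φ`, i.e. the magma algebra of the free magma on two generators. -/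
abbrev FNA (Φ : Type*) [CommRing Φ] := FreeNonUnitalNonAssocAlgebra Φ (Fin 2)

/-- The free generators `x₁, x₂` of `Φ⟨x₁,x₂⟩`. -/
noncomputable def fnaX (Φ : Type*) [CommRing Φ] (i : Fin 2) : FNA Φ :=
  FreeNonUnitalNonAssocAlgebra.of Φ i

/-- A `Φ`-algebra automorphism of `A = Φ⟨x₁,x₂⟩`: an additive and multiplicative
equivalence of `A` which is moreover `Φ`-linear. -/
def IsAlgAut {Φ : Type*} [CommRing Φ] (e : FNA Φ ≃+* FNA Φ) : Prop :=
  ∀ (c : Φ) (x : FNA Φ), e (c • x) = c • e x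

/-- An automorphism of `A = Φ⟨x₁,x₂⟩` is elementary if it is `Φ`-linear and has the form
`(x₁ ↦ αx₁ + g, x₂ ↦ x₂)` with `α` a unit and `g` in the subalgebra generated by `x₂`, or
`(x₁ ↦ x₁, x₂ ↦ βx₂ + h)` with `β` a unit and `h` in the subalgebra generated by `x₁`. -/
def IsElementaryFNA {Φ : Type*} [CommRing Φ] (e : FNA Φ ≃+* FNA Φ) : Prop :=
  IsAlgAut e ∧
  ((∃ (α : Φˣ) (g : FNA Φ), g ∈ NonUnitalAlgebra.adjoin Φ {fnaX Φ 1} ∧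
      e (fnaX Φ 0) = (α : Φ) • fnaX Φ 0 + g ∧ e (fnaX Φ 1) = fnaX Φ 1) ∨
   (∃ (β : Φˣ) (h : FNA Φ), h ∈ NonUnitalAlgebra.adjoin Φ {fnaX Φ 0} ∧
      e (fnaX Φ 0) = fnaX Φ 0 ∧ e (fnaX Φ 1) = (β : Φ) • fnaX Φ 1 + h))

/-- The subgroup of tame automorphisms of `Φ⟨x₁,x₂⟩`, generated by the elementary ones. -/
noncomputable def TameFNA (Φ : Type*) [CommRing Φ] : Subgroup (RingAut (FNA Φ)) :=
  Subgroup.closure {e | IsElementaryFNA e}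

/-- `w = zx₁ − x₂²` in `Φ⟨x₁,x₂⟩`. -/
noncomputable def fnaW {Φ : Type*} [CommRing Φ] (z : Φ) : FNA Φ :=
  z • fnaX Φ 0 - fnaX Φ 1 * fnaX Φ 1

/-- `b₁ = x₁ + x₂(zx₁ − x₂²) + (zx₁ − x₂²)x₂ + z(zx₁ − x₂²)²`. -/
noncomputable def etaB₁ {Φ : Type*} [CommRing Φ] (z : Φ) : FNA Φ :=
  fnaX Φ 0 + fnaX Φ 1 * fnaW z + fnaW z * fnaX Φ 1 + z • (fnaW z * fnaW z)

/-- `b₂ = x₂ + z(zx₁ − x₂²)`. -/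
noncomputable def etaB₂ {Φ : Type*} [CommRing Φ] (z : Φ) : FNA Φ :=
  fnaX Φ 1 + z • fnaW z

/-- `Φ` together with `ν` is a Euclidean ring: an integral domain, not a field, with a norm
`ν` on nonzero elements such that (E1) `ν a ≤ ν (a*b)` with equality iff `b` is a unit, and
(E2) division with remainder holds. -/
structure IsEuclideanNorm (Φ : Type*) [CommRing Φ] [IsDomain Φ] (ν : Φ → ℕ) : Prop where
  not_field : ¬ IsField Φ
  norm_le : ∀ a b : Φ, a ≠ 0 → b ≠ 0 → ν a ≤ ν (a * b)
  norm_eq_iff_unit : ∀ a b : Φ, a ≠ 0 → b ≠ 0 → (ν (a * b) = ν a ↔ IsUnit b)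
  division : ∀ a b : Φ, b ≠ 0 → ∃ q r : Φ, a = b * q + r ∧ (r = 0 ∨ ν r < ν b)

namespace Polynomial

variable {R : Type*} [CommRing R]

/-- Pairs of polynomials obtained from `(X ^ 3, X ^ 2)` by alternating invertible linear changes
with nonlinear shears `(f, g) ↦ (f + g ^ 2 * r(g), g)` that strictly increase the degree. -/
inductive ShearPair : Polynomial R → Polynomial R → Prop
  | base {F G : Polynomial R} (a b c d : R) (hdet : IsUnit (a * d - b * c))
      (hF : F = C a * X ^ 3 + C b * X ^ 2) (hG : G = C c * X ^ 3 + C d * X ^ 2) : ShearPair F G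
  | step {F G : Polynomial R} (f g r : Polynomial R) (hfg : ShearPair f g)
      (hdeg : f.natDegree < 2 * g.natDegree) (hr : r ≠ 0)
      (a b c d : R) (hdet : IsUnit (a * d - b * c))
      (hF : F = C a * (f + g ^ 2 * r.comp g) + C b * g)
      (hG : G = C c * (f + g ^ 2 * r.comp g) + C d * g) : ShearPair F G

theorem ShearPair.linear {F G : Polynomial R} (h : ShearPair F G) {a b c d : R}
    (hdet : IsUnit (a * d - b * c)) : ShearPair (C a * F + C b * G) (C c * F + C d * G) := by
  have key (a' b' c' d' : R) (h' : IsUnit (a' * d' - b' * c')) :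
      IsUnit ((a * a' + b * c') * (c * b' + d * d') - (a * b' + b * d') * (c * a' + d * c')) := by
    convert hdet.mul h' using 1
    ring
  cases h with
  | base a' b' c' d' h' hF hG =>
    refine .base _ _ _ _ (key a' b' c' d' h') ?_ ?_ <;>
    · simp only [hF, hG, map_add, map_mul]
      ring
  | step f g r hfg hdeg hr a' b' c' d' h' hF hG =>
    refine .step f g r hfg hdeg hr _ _ _ _ (key a' b' c' d' h') ?_ ?_ <;>
    · simp only [hF, hG, map_add, map_mul]
      ring

theorem ShearPair.swap {F G : Polynomial R} (h : ShearPair F G) : ShearPair G F := by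
  simpa using h.linear (a := 0) (b := 1) (c := 1) (d := 0) (by simp)

theorem natDegree_linear_comb_le {h g : Polynomial R} (hlt : g.natDegree ≤ h.natDegree) (a b : R) :
    (C a * h + C b * g).natDegree ≤ h.natDegree :=
  natDegree_add_le_of_degree_le (natDegree_C_mul_le _ _) ((natDegree_C_mul_le _ _).trans hlt)

variable [IsDomain R]

theorem natDegree_add_sq_mul_comp {f g r : Polynomial R} (hdeg : f.natDegree < 2 * g.natDegree)
    (hr : r ≠ 0) :
    (f + g ^ 2 * r.comp g).natDegree = (r.natDegree + 2) * g.natDegree ∧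
      (f + g ^ 2 * r.comp g).leadingCoeff =
        r.leadingCoeff * g.leadingCoeff ^ (r.natDegree + 2) := by
  have hg : g.natDegree ≠ 0 := by omega
  have h1 : g ^ 2 * r.comp g = (X ^ 2 * r).comp g := by simp
  have h2 : (X ^ 2 * r).natDegree = r.natDegree + 2 := by
    rw [natDegree_X_pow_mul _ hr]
  have h3 : (g ^ 2 * r.comp g).natDegree = (r.natDegree + 2) * g.natDegree := by
    rw [h1, natDegree_comp, h2]
  have h4 : f.natDegree < (g ^ 2 * r.comp g).natDegree := by
    rw [h3]
    nlinarith
  refine ⟨by rw [natDegree_add_eq_right_of_natDegree_lt h4, h3], ?_⟩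
  rw [leadingCoeff_add_of_degree_lt (degree_lt_degree h4), h1, leadingCoeff_comp hg, h2]
  simp

theorem natDegree_linear_comb {h g : Polynomial R} (hlt : g.natDegree < h.natDegree) {a : R} (ha : a ≠ 0)
    (b : R) : (C a * h + C b * g).natDegree = h.natDegree ∧
      (C a * h + C b * g).leadingCoeff = a * h.leadingCoeff := by
  have h1 : (C a * h).natDegree = h.natDegree := natDegree_C_mul ha
  have h2 : (C b * g).natDegree < (C a * h).natDegree := by
    rw [h1]
    exact (natDegree_C_mul_le _ _).trans_lt hlt
  refine ⟨by rw [natDegree_add_eq_left_of_natDegree_lt h2, h1], ?_⟩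
  rw [leadingCoeff_add_of_degree_lt' (degree_lt_degree h2)]
  simp

theorem ShearPair.elementary {F G : Polynomial R} (h : ShearPair F G) {α : R} (hα : IsUnit α) (p : Polynomial R) :
    ShearPair (C α * F + G * p.comp G) G := by
  obtain ⟨s, t, rfl⟩ : ∃ (s : R) (t : Polynomial R), p = X * t + C s :=
    ⟨p.coeff 0, p.divX, (X_mul_divX_add p).symm⟩
  have hsplit : C α * F + G * (X * t + C s).comp G =
      C α * (F + G ^ 2 * (C (↑hα.unit⁻¹ : R) * t).comp G) + C s * G := by
    have h1 : C α * C (↑hα.unit⁻¹ : R) = 1 := by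
      rw [← C_mul, hα.mul_val_inv, C_1]
    simp only [add_comp, mul_comp, X_comp, C_comp]
    linear_combination (-(G ^ 2 * t.comp G)) * h1
  rw [hsplit]
  generalize C (↑hα.unit⁻¹ : R) * t = r
  suffices H : ShearPair (F + G ^ 2 * r.comp G) G by
    simpa using H.linear (a := α) (b := s) (c := 0) (d := 1) (by simpa using hα)
  by_cases hr : r = 0
  · simpa [hr] using h
  have shear (hlt : F.natDegree < 2 * G.natDegree) : ShearPair (F + G ^ 2 * r.comp G) G :=
    .step F G r h hlt hr 1 0 0 1 (by simp) (by simp) (by simp)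
  cases h with
  | base a b c d hdet hF hG =>
    apply shear
    have hlt : (X ^ 2 : Polynomial R).natDegree < (X ^ 3 : Polynomial R).natDegree := by simp
    have h1 := natDegree_linear_comb_le hlt.le a b
    rw [← hF] at h1
    have h2 : 2 ≤ G.natDegree := by
      by_cases hc : c = 0
      · have hd : d ≠ 0 := by
          rintro rfl
          simp [hc] at hdet
        simp [hG, hc, hd]
      · have h3 := (natDegree_linear_comb hlt hc d).1
        rw [← hG] at h3
        simp [h3]
    simp at h1
    omega
  | step f g r₀ hfg hdeg hr₀ a b c d hdet hF hG =>
    have hdg := (natDegree_add_sq_mul_comp hdeg hr₀).1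
    have hlt : g.natDegree < (f + g ^ 2 * r₀.comp g).natDegree := by
      rw [hdg]
      nlinarith
    by_cases hc : c = 0
    · subst hc
      rw [mul_zero, sub_zero] at hdet
      have ha : IsUnit a := isUnit_of_mul_isUnit_left hdet
      have hGd : G = C d * g := by simp [hG]
      have h1 : C a * C (↑ha.unit⁻¹ : R) = 1 := by
        rw [← C_mul, ha.mul_val_inv, C_1]
      have hnew : F + G ^ 2 * r.comp G = C a * (f + g ^ 2 *
          (r₀ + C (↑ha.unit⁻¹ : R) * C d ^ 2 * r.comp (C d * X)).comp g) + C b * g := by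
        rw [hF, hGd]
        simp only [add_comp, mul_comp, X_comp, C_comp, pow_comp, comp_assoc]
        linear_combination (-(g ^ 2 * C d ^ 2 * r.comp (C d * g))) * h1
      rw [hnew]
      by_cases hr' : r₀ + C (↑ha.unit⁻¹ : R) * C d ^ 2 * r.comp (C d * X) = 0
      · rw [hr', hGd]
        simpa using hfg.linear (a := a) (b := b) (c := 0) (d := d) (by simpa using hdet)
      · exact .step f g _ hfg hdeg hr' a b 0 d (by simpa using hdet) rfl (by simp [hGd])
    · apply shear
      have h2 := natDegree_linear_comb_le hlt.le a b
      have h3 := (natDegree_linear_comb hlt hc d).1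
      rw [← hF] at h2
      rw [← hG] at h3
      omega

theorem ShearPair.elementary_iff {F G : Polynomial R} {α : R} (hα : IsUnit α) (p : Polynomial R) :
    ShearPair (C α * F + G * p.comp G) G ↔ ShearPair F G := by
  refine ⟨fun h => ?_, fun h => h.elementary hα p⟩
  have h1 : C α * C (↑hα.unit⁻¹ : R) = 1 := by
    rw [← C_mul, hα.mul_val_inv, C_1]
  convert h.elementary (hα.unit⁻¹).isUnit (-(C (↑hα.unit⁻¹ : R) * p)) using 1
  simp only [neg_comp, mul_comp, C_comp]
  linear_combination -F * h1

/-- If the degrees in a shear pair are strictly decreasing, then the leading coefficient of the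
first entry is divisible by the square of that of the second, provided the degrees are large. -/
theorem ShearPair.sq_leadingCoeff_dvd {F G : Polynomial R} (h : ShearPair F G)
    (hlt : G.natDegree < F.natDegree) (hF3 : 3 < F.natDegree) :
    G.leadingCoeff ^ 2 ∣ F.leadingCoeff := by
  cases h with
  | base a b c d hdet hF hG =>
    have h1 := natDegree_linear_comb_le (h := (X ^ 3 : Polynomial R)) (g := X ^ 2) (by simp) a b
    rw [← hF, natDegree_X_pow] at h1
    omega
  | step f g r hfg hdeg hr a b c d hdet hF hG =>
    obtain ⟨hdg, hlc⟩ := natDegree_add_sq_mul_comp hdeg hr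
    have hgh : g.natDegree < (f + g ^ 2 * r.comp g).natDegree := by
      rw [hdg]
      nlinarith
    by_cases hc : c = 0
    · subst hc
      rw [mul_zero, sub_zero] at hdet
      have ha : a ≠ 0 := by
        rintro rfl
        simp at hdet
      have hd : IsUnit d := isUnit_of_mul_isUnit_right hdet
      have h2 : G.leadingCoeff = d * g.leadingCoeff := by simp [hG]
      rw [hF, (natDegree_linear_comb hgh ha b).2, hlc, h2, mul_pow, (hd.pow 2).mul_left_dvd]
      exact Dvd.dvd.mul_left (Dvd.dvd.mul_left (pow_dvd_pow _ (by omega)) _) _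
    · have h2 := natDegree_linear_comb_le hgh.le a b
      have h3 := (natDegree_linear_comb hgh hc d).1
      rw [← hF] at h2
      rw [← hG] at h3
      omega

end Polynomial

theorem exists_polynomial_of_mem_adjoin_singleton {Φ : Type*} [CommRing Φ] {x h : FNA Φ}
    (hh : h ∈ NonUnitalAlgebra.adjoin Φ {x}) :
    ∃ p : Polynomial Φ, ∀ φ : FNA Φ →ₙₐ[Φ] Polynomial Φ, φ h = φ x * p.comp (φ x) := by
  induction hh using NonUnitalAlgebra.adjoin_induction with
  | mem y hy =>
    obtain rfl := Set.mem_singleton_iff.1 hy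
    exact ⟨1, fun φ => by simp⟩
  | add y w _ _ hy hw =>
    obtain ⟨p, hp⟩ := hy
    obtain ⟨q, hq⟩ := hw
    exact ⟨p + q, fun φ => by rw [map_add, hp, hq, Polynomial.add_comp, mul_add]⟩
  | zero => exact ⟨0, fun φ => by simp⟩
  | mul y w _ _ hy hw =>
    obtain ⟨p, hp⟩ := hy
    obtain ⟨q, hq⟩ := hw
    refine ⟨Polynomial.X * p * q, fun φ => ?_⟩
    rw [map_mul, hp, hq]
    simp only [Polynomial.mul_comp, Polynomial.X_comp]
    ring
  | smul c y _ hy =>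
    obtain ⟨p, hp⟩ := hy
    exact ⟨c • p, fun φ => by rw [map_smul, hp, Polynomial.smul_comp, mul_smul_comm]⟩

/-- Precomposition of an algebra homomorphism with an algebra automorphism. -/
noncomputable def IsAlgAut.precomp {Φ : Type*} [CommRing Φ] {e : FNA Φ ≃+* FNA Φ} (he : IsAlgAut e)
    (φ : FNA Φ →ₙₐ[Φ] Polynomial Φ) : FNA Φ →ₙₐ[Φ] Polynomial Φ where
  toFun x := φ (e x)
  map_smul' c x := by simp [he c x]
  map_zero' := by simp
  map_add' x y := by simp
  map_mul' x y := by simp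

theorem IsElementaryFNA.shearPair_iff {Φ : Type*} [CommRing Φ] [IsDomain Φ] {e : FNA Φ ≃+* FNA Φ}
    (he : IsElementaryFNA e) (φ : FNA Φ →ₙₐ[Φ] Polynomial Φ) :
    Polynomial.ShearPair (φ (e (fnaX Φ 0))) (φ (e (fnaX Φ 1))) ↔
      Polynomial.ShearPair (φ (fnaX Φ 0)) (φ (fnaX Φ 1)) := by
  obtain ⟨-, ⟨α, g, hg, h0, h1⟩ | ⟨α, g, hg, h0, h1⟩⟩ := he
  · obtain ⟨p, hp⟩ := exists_polynomial_of_mem_adjoin_singleton hg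
    rw [h0, h1, map_add, map_smul, hp, Polynomial.smul_eq_C_mul]
    exact Polynomial.ShearPair.elementary_iff α.isUnit p
  · obtain ⟨p, hp⟩ := exists_polynomial_of_mem_adjoin_singleton hg
    rw [h0, h1, map_add, map_smul, hp, Polynomial.smul_eq_C_mul]
    exact ⟨fun h => ((Polynomial.ShearPair.elementary_iff α.isUnit p).1 h.swap).swap,
      fun h => (h.swap.elementary α.isUnit p).swap⟩

theorem shearPair_iff_of_mem_tameFNA {Φ : Type*} [CommRing Φ] [IsDomain Φ]
    {e : RingAut (FNA Φ)} (he : e ∈ TameFNA Φ) :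
    IsAlgAut e ∧ ∀ φ : FNA Φ →ₙₐ[Φ] Polynomial Φ,
      (Polynomial.ShearPair (φ (e (fnaX Φ 0))) (φ (e (fnaX Φ 1))) ↔
        Polynomial.ShearPair (φ (fnaX Φ 0)) (φ (fnaX Φ 1))) := by
  induction he using Subgroup.closure_induction with
  | mem e he => exact ⟨he.1, he.shearPair_iff⟩
  | one => exact ⟨fun c x => rfl, fun φ => Iff.rfl⟩
  | mul e₁ e₂ _ _ h₁ h₂ =>
    refine ⟨fun c x => ?_, fun φ => (h₂.2 (h₁.1.precomp φ)).trans (h₁.2 φ)⟩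
    rw [RingAut.mul_apply, RingAut.mul_apply, h₂.1, h₁.1]
  | inv e _ h =>
    have hinv : IsAlgAut e⁻¹ := fun c x => by
      apply e.injective
      exact (e.apply_symm_apply _).trans ((congrArg (c • ·) (e.apply_symm_apply x)).symm.trans
        (h.1 c _).symm)
    refine ⟨hinv, fun φ => ?_⟩
    have h2 := h.2 (hinv.precomp φ)
    change Polynomial.ShearPair (φ (e⁻¹ (e _))) (φ (e⁻¹ (e _))) ↔ _ at h2
    rw [show e⁻¹ (e _) = _ from e.symm_apply_apply _, show e⁻¹ (e _) = _ from e.symm_apply_apply _]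
      at h2
    exact h2.symm

/-- Over a Euclidean ring `Φ` with `z ∈ Φ` a nonzero non-unit, the automorphism `η` of the
free nonassociative algebra `A = Φ⟨x₁,x₂⟩` given by
`η(x₁) = x₁ + x₂(zx₁ − x₂²) + (zx₁ − x₂²)x₂ + z(zx₁ − x₂²)²`, `η(x₂) = x₂ + z(zx₁ − x₂²)`
is wild: it does not lie in the subgroup of `Aut(A)` generated by the elementary
automorphisms. -/
theorem eta_is_wild
    (Φ : Type*) [CommRing Φ] [IsDomain Φ] (ν : Φ → ℕ) (hν : IsEuclideanNorm Φ ν)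
    (z : Φ) (hz0 : z ≠ 0) (hz : ¬ IsUnit z)
    (η : FNA Φ ≃+* FNA Φ) (hη : IsAlgAut η)
    (hη₁ : η (fnaX Φ 0) = etaB₁ z) (hη₂ : η (fnaX Φ 1) = etaB₂ z) :
    η ∉ TameFNA Φ := by
  intro hmem
  let φ : FNA Φ →ₙₐ[Φ] Polynomial Φ :=
    FreeNonUnitalNonAssocAlgebra.lift Φ ![Polynomial.X ^ 3, Polynomial.X ^ 2]
  have hφ0 : φ (fnaX Φ 0) = Polynomial.X ^ 3 := by
    simp [φ, fnaX, FreeNonUnitalNonAssocAlgebra.lift_of_apply]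
  have hφ1 : φ (fnaX Φ 1) = Polynomial.X ^ 2 := by
    simp [φ, fnaX, FreeNonUnitalNonAssocAlgebra.lift_of_apply]
  have hshear := ((shearPair_iff_of_mem_tameFNA hmem).2 φ).2
    (.base 1 0 0 1 (by simp) (by simp [hφ0]) (by simp [hφ1]))
  have hF : φ (η (fnaX Φ 0)) = Polynomial.C z * Polynomial.X ^ 8 +
      (Polynomial.C (-2 * z ^ 2) * Polynomial.X ^ 7 +
      Polynomial.C (z ^ 3 - 2) * Polynomial.X ^ 6 + Polynomial.C (2 * z) * Polynomial.X ^ 5 +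
      Polynomial.X ^ 3) := by
    rw [hη₁]
    simp only [etaB₁, fnaW, map_add, map_sub, map_mul, map_smul, hφ0, hφ1,
      Polynomial.smul_eq_C_mul, map_pow, map_neg, map_ofNat]
    ring
  have hG : φ (η (fnaX Φ 1)) = Polynomial.C (-z) * Polynomial.X ^ 4 +
      (Polynomial.C (z ^ 2) * Polynomial.X ^ 3 + Polynomial.X ^ 2) := by
    rw [hη₂]
    simp only [etaB₂, fnaW, map_add, map_sub, map_mul, map_smul, hφ0, hφ1,
      Polynomial.smul_eq_C_mul, map_pow, map_neg]
    ring
  have hFd : (φ (η (fnaX Φ 0))).natDegree = 8 := by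
    rw [hF]
    compute_degree!
  have hGd : (φ (η (fnaX Φ 1))).natDegree = 4 := by
    rw [hG]
    compute_degree!
  have hdvd := hshear.sq_leadingCoeff_dvd (by omega) (by omega)
  have hFl : (φ (η (fnaX Φ 0))).leadingCoeff = z := by
    rw [Polynomial.leadingCoeff, hFd, hF]
    simp [Polynomial.coeff_X_pow, -map_mul, -map_sub, -map_pow, -map_neg, -neg_mul]
  have hGl : (φ (η (fnaX Φ 1))).leadingCoeff = -z := by
    rw [Polynomial.leadingCoeff, hGd, hG]
    simp [Polynomial.coeff_X_pow, -map_mul, -map_sub, -map_pow, -map_neg]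
  rw [hFl, hGl, neg_sq] at hdvd
  obtain ⟨c, hc⟩ := hdvd
  exact hz (IsUnit.of_mul_eq_one c (mul_left_cancel₀ hz0 (by linear_combination -hc)))
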